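/- arXiv:2512.01173 — 2 statements merged into one kernel-verified Lean document; each statement's English description precedes it below -/
import Mathlib

section
/- Let T : A(𝕋)₊ → A(𝕋)₊ be a surjective map satisfying (T f + T g)(𝕋) = (f + g)(𝕋) for all f, g ∈ A(𝕋)₊. Then for every n ∈ ℤ there exists a unique m ∈ ℤ such that T applied to the function z ↦ z^n equals the function z ↦ z^m. -/
/-- The `n`-th Fourier coefficient of a function on the unit circle:
`f̂(n) = (1/2π) ∫₀^{2π} f(e^{iθ}) e^{-inθ} dθ`. -/
noncomputable def fourierCoeffCircle (f : Circle → ℂ) (n : ℤ) : ℂ :=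
  (1 / (2 * Real.pi)) * ∫ θ in (0:ℝ)..(2 * Real.pi),
    f (Circle.exp θ) * Complex.exp (-(n : ℂ) * Complex.I * θ)

/-- Membership in the Wiener algebra `A(𝕋)`: continuous functions on the circle
whose Fourier coefficients are absolutely summable. -/
def InWiener (f : Circle → ℂ) : Prop :=
  Continuous f ∧ Summable fun n : ℤ => ‖fourierCoeffCircle f n‖

/-- Membership in the positive cone `A(𝕋)₊`: members of the Wiener algebra all of
whose Fourier coefficients are nonnegative real numbers. -/
def InWienerPlus (f : Circle → ℂ) : Prop :=
  InWiener f ∧ ∀ n : ℤ, ∃ r : ℝ, 0 ≤ r ∧ fourierCoeffCircle f n = (r : ℂ)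

instance fact_zero_lt_two_pi : Fact (0 < 2 * Real.pi) :=
  ⟨Real.two_pi_pos⟩

theorem fourierCoeffCircle_eq_fourierCoeff (f : Circle → ℂ) (n : ℤ) :
    fourierCoeffCircle f n =
      fourierCoeff (fun x : AddCircle (2 * Real.pi) => f (AddCircle.toCircle x)) n := by
  have hpi : (Real.pi : ℂ) ≠ 0 := by exact_mod_cast Real.pi_ne_zero
  rw [fourierCoeff_eq_intervalIntegral _ _ 0, fourierCoeffCircle, zero_add, Complex.real_smul]
  congr 1
  · push_cast
    rfl
  · refine intervalIntegral.integral_congr fun θ _ => ?_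
    simp only [AddCircle.toCircle_apply_mk, fourier_coe_apply, smul_eq_mul]
    rw [div_self Real.two_pi_pos.ne', one_mul, mul_comm]
    congr 2
    push_cast
    field_simp

theorem coe_toCircle_zpow_eq_fourier {T : ℝ} (n : ℤ) (x : AddCircle T) :
    (AddCircle.toCircle x : ℂ) ^ n = fourier n x := by
  rw [fourier_apply, AddCircle.toCircle_zsmul, Circle.coe_zpow]

theorem fourierCoeffCircle_zpow (n : ℤ) :
    fourierCoeffCircle (fun z : Circle => (z : ℂ) ^ n) = Pi.single n 1 := by
  funext k
  rw [fourierCoeffCircle_eq_fourierCoeff, ← fourierCoeff_fourier (T := 2 * Real.pi) n]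
  simp only [coe_toCircle_zpow_eq_fourier]

theorem inWienerPlus_zpow (n : ℤ) : InWienerPlus (fun z : Circle => (z : ℂ) ^ n) := by
  refine ⟨⟨?_, ?_⟩, fun k => ?_⟩
  · simp_rw [← Circle.coe_zpow]
    exact continuous_subtype_val.comp (continuous_zpow n)
  · rw [fourierCoeffCircle_zpow]
    refine summable_of_ne_finset_zero (s := {n}) fun k hk => ?_
    rw [Finset.mem_singleton] at hk
    simp [hk]
  · rw [fourierCoeffCircle_zpow]
    obtain rfl | hk := eq_or_ne k n
    · exact ⟨1, zero_le_one, by simp⟩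
    · exact ⟨0, le_rfl, by simp [hk]⟩

theorem InWiener.hasSum {f : Circle → ℂ} (hf : InWiener f) (z : Circle) :
    HasSum (fun n : ℤ => fourierCoeffCircle f n * (z : ℂ) ^ n) (f z) := by
  let F : C(AddCircle (2 * Real.pi), ℂ) :=
    ⟨fun x => f (AddCircle.toCircle x), hf.1.comp AddCircle.continuous_toCircle⟩
  have hF : fourierCoeff F = fourierCoeffCircle f :=
    funext fun n => (fourierCoeffCircle_eq_fourierCoeff f n).symm
  obtain ⟨x, rfl⟩ := (AddCircle.homeomorphCircle Real.two_pi_pos.ne').surjective z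
  have h := has_pointwise_sum_fourier_series_of_summable (f := F) (hF ▸ hf.2.of_norm) x
  rw [hF] at h
  simp only [AddCircle.homeomorphCircle_apply, coe_toCircle_zpow_eq_fourier]
  exact h

theorem hasSum_sq_fourierCoeffCircle {f : Circle → ℂ} (hf : Continuous f)
    (hunit : ∀ z, ‖f z‖ = 1) : HasSum (fun n : ℤ => ‖fourierCoeffCircle f n‖ ^ 2) 1 := by
  let F : C(AddCircle (2 * Real.pi), ℂ) :=
    ⟨fun x => f (AddCircle.toCircle x), hf.comp AddCircle.continuous_toCircle⟩
  have h := hasSum_sq_fourierCoeff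
    (ContinuousMap.toLp (E := ℂ) 2 AddCircle.haarAddCircle ℂ F)
  simp only [fourierCoeff_toLp] at h
  convert h using 1
  · funext n
    rw [fourierCoeffCircle_eq_fourierCoeff]
    rfl
  · have hae : ∀ᵐ t ∂(AddCircle.haarAddCircle (T := 2 * Real.pi)),
        ‖ContinuousMap.toLp (E := ℂ) 2 AddCircle.haarAddCircle ℂ F t‖ ^ 2 = (1 : ℝ) := by
      filter_upwards [ContinuousMap.coeFn_toLp (𝕜 := ℂ) (p := 2) AddCircle.haarAddCircle F] with t ht
      rw [ht]
      simp [F, hunit]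
    rw [MeasureTheory.integral_congr_ae hae]
    simp

theorem exists_eq_single_of_hasSum_sq {ι : Type*} [DecidableEq ι] {a : ι → ℝ}
    (ha : ∀ i, 0 ≤ a i) (h₁ : HasSum a 1) (h₂ : HasSum (fun i => a i ^ 2) 1) :
    ∃ i, a = Pi.single i 1 := by
  have hle (i : ι) : a i ≤ 1 := le_hasSum h₁ i fun j _ => ha j
  have hdiff : HasSum (fun i => a i - a i ^ 2) 0 := by simpa using h₁.sub h₂
  have hzero := (hasSum_zero_iff_of_nonneg fun i => by
    nlinarith [ha i, hle i]).1 hdiff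
  obtain ⟨i, hi⟩ : ∃ i, a i ≠ 0 := by
    by_contra! h
    rw [funext h] at h₁
    exact zero_ne_one (hasSum_zero.unique h₁)
  have hi1 : a i = 1 := by
    have : a i * (1 - a i) = 0 := by
      have := congrFun hzero i
      simp only [Pi.zero_apply] at this
      linarith
    rcases mul_eq_zero.1 this with h | h
    · exact absurd h hi
    · linarith
  refine ⟨i, funext fun j => ?_⟩
  obtain rfl | hj := eq_or_ne j i
  · simpa using hi1
  · have hsum := sum_le_hasSum {i, j} (fun k _ => ha k) h₁
    rw [Finset.sum_pair hj.symm] at hsum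
    rw [Pi.single_eq_of_ne hj]
    linarith [ha j]

/-- A unimodular function in the positive cone of the Wiener algebra is a monomial. -/
theorem InWienerPlus.exists_eq_zpow {f : Circle → ℂ} (hf : InWienerPlus f)
    (hunit : ∀ z, ‖f z‖ = 1) : ∃ m : ℤ, f = fun z : Circle => (z : ℂ) ^ m := by
  choose a ha hfa using hf.2
  have hsum : HasSum a 1 := by
    have h : HasSum (fun n => (a n : ℂ)) (f 1) := by
      simpa [hfa] using hf.1.hasSum 1
    have hs : HasSum a (f 1).re := by simpa using Complex.hasSum_re h
    have hf1 : f 1 = ((f 1).re : ℂ) := h.unique (Complex.hasSum_ofReal.2 hs)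
    have hre : (f 1).re = 1 := by
      rw [← hunit 1, hf1, Complex.norm_real, Complex.ofReal_re,
        Real.norm_of_nonneg (hs.nonneg ha)]
    rwa [hre] at hs
  have hsq : HasSum (fun n => a n ^ 2) 1 := by
    simpa [hfa] using hasSum_sq_fourierCoeffCircle hf.1.1 hunit
  obtain ⟨m, rfl⟩ := exists_eq_single_of_hasSum_sq ha hsum hsq
  refine ⟨m, funext fun z => (hf.1.hasSum z).unique ?_⟩
  convert hasSum_single m fun k hk => ?_ using 1
  · simp [hfa]
  · simp [hfa, hk]

theorem T_monomial_is_monomial (T : (Circle → ℂ) → (Circle → ℂ))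
    (hmap : ∀ f, InWienerPlus f → InWienerPlus (T f))
    (hsurj : ∀ g, InWienerPlus g → ∃ f, InWienerPlus f ∧ T f = g)
    (hspec : ∀ f g, InWienerPlus f → InWienerPlus g →
      (Set.range fun z => T f z + T g z) = (Set.range fun z => f z + g z)) :
    ∀ n : ℤ, ∃! m : ℤ, T (fun z : Circle => (z : ℂ) ^ n) = fun z : Circle => (z : ℂ) ^ m := by
  intro n
  have hn := inWienerPlus_zpow n
  have hunit (z : Circle) : ‖T (fun z : Circle => (z : ℂ) ^ n) z‖ = 1 := by
    obtain ⟨w, hw⟩ := (hspec _ _ hn hn).subset (Set.mem_range_self z)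
    simp only [← two_mul] at hw
    rw [← mul_left_cancel₀ two_ne_zero hw]
    rw [norm_zpow, Circle.norm_coe, one_zpow]
  obtain ⟨m, hm⟩ := (hmap _ hn).exists_eq_zpow hunit
  refine ⟨m, hm, fun k hk => ?_⟩
  have h := congrFun (congrArg fourierCoeffCircle (hk.symm.trans hm)) k
  rw [fourierCoeffCircle_zpow, fourierCoeffCircle_zpow, Pi.single_eq_same] at h
  by_contra hkm
  rw [Pi.single_eq_of_ne hkm] at h
  exact one_ne_zero h
end

section
/- Let T : A(𝕋)₊ → A(𝕋)₊ be a surjective map satisfying (T f + T g)(𝕋) = (f + g)(𝕋) for all f, g ∈ A(𝕋)₊. Suppose n, m ∈ ℤ are such that T applied to the function z ↦ z^n equals the function z ↦ z^m. Then for every real λ > 0, T applied to the function z ↦ λ z^n equals the function z ↦ λ z^m. -/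
theorem fourierCoeffCircle_const_mul_zpow (c : ℂ) (n k : ℤ) :
    fourierCoeffCircle (fun z : Circle => c * (z : ℂ) ^ n) k = if k = n then c else 0 := by
  have integrand (θ : ℝ) : c * (Circle.exp θ : ℂ) ^ n * Complex.exp (-(k : ℂ) * Complex.I * θ)
      = c * Complex.exp (((n : ℂ) - k) * Complex.I * θ) := by
    rw [Circle.coe_exp, ← Complex.exp_int_mul, mul_assoc, ← Complex.exp_add]
    ring_nf
  simp only [fourierCoeffCircle, integrand, intervalIntegral.integral_const_mul]
  split_ifs with h
  · subst h
    have hpi : (Real.pi : ℂ) ≠ 0 := by exact_mod_cast Real.pi_ne_zero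
    simp
    field_simp
  · have hnk : ((n : ℂ) - k) * Complex.I ≠ 0 :=
      mul_ne_zero (sub_ne_zero.2 (by exact_mod_cast Ne.symm h)) Complex.I_ne_zero
    have hperiod : Complex.exp (((n : ℂ) - k) * Complex.I * (2 * Real.pi)) = 1 :=
      Complex.exp_eq_one_iff.2 ⟨n - k, by push_cast; ring⟩
    rw [integral_exp_mul_complex hnk]
    simp [hperiod]

theorem inWienerPlus_const_mul_zpow {r : ℝ} (hr : 0 ≤ r) (n : ℤ) :
    InWienerPlus (fun z : Circle => (r : ℂ) * (z : ℂ) ^ n) := by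
  refine ⟨⟨?_, ?_⟩, fun k => ?_⟩
  · exact continuous_const.mul
      (continuous_subtype_val.zpow₀ n fun z => Or.inl (Circle.coe_ne_zero z))
  · refine summable_of_ne_finset_zero (s := {n}) fun k hk => ?_
    rw [fourierCoeffCircle_const_mul_zpow, if_neg (by simpa using hk), norm_zero]
  · rw [fourierCoeffCircle_const_mul_zpow]
    split_ifs
    · exact ⟨r, hr, rfl⟩
    · exact ⟨0, le_rfl, by simp⟩

theorem eq_real_mul_of_norm_add_eq {E : Type*} [NormedAddCommGroup E] [NormedSpace ℝ E]
    [StrictConvexSpace ℝ E] {u v : E} (hv : ‖v‖ = 1) (h : ‖u + v‖ = ‖u‖ + ‖v‖) :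
    u = ‖u‖ • v := by
  have := sameRay_iff_norm_smul_eq.1 (sameRay_iff_norm_add.2 h)
  simpa [hv] using this.symm

theorem T_scaled_monomial (T : (Circle → ℂ) → (Circle → ℂ))
    (hmap : ∀ f, InWienerPlus f → InWienerPlus (T f))
    (hsurj : ∀ g, InWienerPlus g → ∃ f, InWienerPlus f ∧ T f = g)
    (hspec : ∀ f g, InWienerPlus f → InWienerPlus g →
      (Set.range fun z => T f z + T g z) = (Set.range fun z => f z + g z))
    (n m : ℤ)
    (hT : T (fun z : Circle => (z : ℂ) ^ n) = fun z : Circle => (z : ℂ) ^ m) :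
    ∀ lam : ℝ, 0 < lam →
      T (fun z : Circle => (lam : ℂ) * (z : ℂ) ^ n) =
        fun z : Circle => (lam : ℂ) * (z : ℂ) ^ m := by
  intro lam hlam
  have hf := inWienerPlus_const_mul_zpow hlam.le n
  set f : Circle → ℂ := fun z => (lam : ℂ) * (z : ℂ) ^ n
  funext z
  have hnorm : ‖T f z‖ = lam := by
    obtain ⟨w, hw⟩ := (hspec f f hf hf).subset ⟨z, rfl⟩
    have := congrArg norm hw
    simp only [f, ← two_mul, norm_mul, norm_zpow, Circle.norm_coe, one_zpow, Complex.norm_real,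
      Real.norm_of_nonneg hlam.le, Complex.norm_ofNat] at this
    linarith
  have hnorm_add : ‖T f z + (z : ℂ) ^ m‖ = lam + 1 := by
    obtain ⟨w, hw⟩ := (hspec f _ hf (inWienerPlus_zpow n)).subset ⟨z, rfl⟩
    simp only [hT, f] at hw
    rw [← hw, ← add_one_mul, norm_mul, norm_zpow, Circle.norm_coe, one_zpow, mul_one]
    exact_mod_cast Real.norm_of_nonneg (by positivity : 0 ≤ lam + 1)
  have hz : ‖(z : ℂ) ^ m‖ = 1 := by rw [norm_zpow, Circle.norm_coe, one_zpow]
  have := eq_real_mul_of_norm_add_eq hz (by rw [hnorm_add, hnorm, hz])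
  rwa [hnorm, Complex.real_smul] at this
end
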